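/- Let n ≥ 1 and for a real n×n matrix A define E_k(A), 0 ≤ k ≤ n, as the coefficient of t^{n−k} in the polynomial det(t·I + A), so that E_0(A) = 1, E_1(A) = tr(A), and E_n(A) = det(A). Then for every 0 ≤ k ≤ n−1 each function A ↦ E_k(A) is Fréchet differentiable on the space of n×n real matrices, and for all n×n real matrices A and H the derivatives satisfy the recursion D E_{k+1}(A)[H] = E_k(A) · tr(H) − D E_k(A)[A·H]. -/

import Mathlib

open Polynomial

attribute [local instance] Matrix.frobeniusNormedAddCommGroup Matrix.frobeniusNormedSpace

/-- `E n k A` is the coefficient of `t^(n-k)` in `det (t • I + A)`, i.e. the `k`-th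
elementary symmetric function of the eigenvalues of `A`. -/
noncomputable def matrixEsymm (n k : ℕ) (A : Matrix (Fin n) (Fin n) ℝ) : ℝ :=
  (Matrix.det
    ((Polynomial.X : Polynomial ℝ) • (1 : Matrix (Fin n) (Fin n) (Polynomial ℝ)) +
      A.map Polynomial.C)).coeff (n - k)

namespace Matrix

variable {m : Type*} [Fintype m]

lemma differentiable_apply (i j : m) :
    Differentiable ℝ fun A : Matrix m m ℝ => A i j :=
  (LinearMap.toContinuousLinearMap (entryLinearMap ℝ ℝ i j)).differentiable

variable [DecidableEq m]

lemma sum_det_updateRow_eq_trace_adjugate_mul {R : Type*} [CommRing R] (B H : Matrix m m R) :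
    ∑ i, (B.updateRow i (H i)).det = (adjugate B * H).trace := by
  rw [trace_mul_comm, trace]
  refine Finset.sum_congr rfl fun i _ => ?_
  rw [← cramer_transpose_apply, cramer_eq_adjugate_mulVec, ← adjugate_transpose, diag_apply,
    mul_apply, mulVec, dotProduct]
  exact Finset.sum_congr rfl fun j _ => mul_comm _ _

/-- Jacobi's formula for the derivative of the determinant. -/
lemma fderiv_det (B H : Matrix m m ℝ) :
    fderiv ℝ (det : Matrix m m ℝ → ℝ) B H = (adjugate B * H).trace := by
  let rowDet : ContinuousMultilinearMap ℝ (fun _ : m => m → ℝ) ℝ :=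
    { (detRowAlternating : (m → ℝ) [⋀^m]→ₗ[ℝ] ℝ).toMultilinearMap with
      cont := Continuous.matrix_det (A := fun M : m → m → ℝ => of M) continuous_id }
  let rows : Matrix m m ℝ →L[ℝ] (m → m → ℝ) :=
    LinearMap.toContinuousLinearMap (ofLinearEquiv ℝ).symm.toLinearMap
  have h : HasFDerivAt (det : Matrix m m ℝ → ℝ) ((rowDet.linearDeriv (rows B)).comp rows) B :=
    (rowDet.hasFDerivAt (rows B)).comp B rows.hasFDerivAt
  rw [h.fderiv, ContinuousLinearMap.comp_apply, ContinuousMultilinearMap.linearDeriv_apply,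
    ← sum_det_updateRow_eq_trace_adjugate_mul]
  rfl

end Matrix

lemma differentiable_coeff_prod {E ι : Type*} [NormedAddCommGroup E] [NormedSpace ℝ E]
    (s : Finset ι) (p : ι → E → ℝ[X])
    (hp : ∀ i ∈ s, ∀ k, Differentiable ℝ fun x => (p i x).coeff k) (k : ℕ) :
    Differentiable ℝ fun x => (∏ i ∈ s, p i x).coeff k := by
  classical
  induction s using Finset.induction_on generalizing k with
  | empty => simp
  | insert a s ha ih =>
    simp only [Finset.prod_insert ha, coeff_mul]
    exact Differentiable.fun_sum fun c _ => (hp a (Finset.mem_insert_self a s) c.1).mul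
      (ih (fun i hi => hp i (Finset.mem_insert_of_mem hi)) c.2)

namespace Matrix

variable {m : Type*} [Fintype m] [DecidableEq m]

lemma differentiable_coeff_det_X_add_C (k : ℕ) :
    Differentiable ℝ fun A : Matrix m m ℝ =>
      (det ((X : ℝ[X]) • (1 : Matrix m m ℝ[X]) + A.map C)).coeff k := by
  simp only [det_apply, finsetSum_coeff, coeff_smul]
  refine Differentiable.fun_sum fun σ _ => ?_
  simp only [Units.smul_def, zsmul_eq_mul]
  refine (differentiable_coeff_prod _ _ (fun i _ l => ?_) k).const_mul _
  simp only [add_apply, map_apply, coeff_add, coeff_C]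
  split_ifs
  · exact (differentiable_apply _ _).const_add _
  · exact differentiable_const _

lemma eval_det_X_add_C {R : Type*} [CommRing R] (A : Matrix m m R) (t : R) :
    (det ((X : R[X]) • (1 : Matrix m m R[X]) + A.map C)).eval t
      = det (t • (1 : Matrix m m R) + A) := by
  rw [← coe_evalRingHom, RingHom.map_det]
  congr 1
  ext i j
  by_cases h : i = j <;> simp [h]

/-- The derivative at `A` in the direction `H` of `A ↦ det (X • 1 + A)`, taken coefficientwise. -/
noncomputable def derivDetXAddC (A H : Matrix m m ℝ) : ℝ[X] :=
  ∑ k ∈ Finset.range (Fintype.card m + 1), monomial k (fderiv ℝ (fun B : Matrix m m ℝ =>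
      (det ((X : ℝ[X]) • (1 : Matrix m m ℝ[X]) + B.map C)).coeff k) A H)

lemma coeff_derivDetXAddC (A H : Matrix m m ℝ) {k : ℕ} (hk : k ≤ Fintype.card m) :
    (derivDetXAddC A H).coeff k = fderiv ℝ (fun B : Matrix m m ℝ =>
      (det ((X : ℝ[X]) • (1 : Matrix m m ℝ[X]) + B.map C)).coeff k) A H := by
  simp [derivDetXAddC, coeff_monomial, hk]

lemma eval_derivDetXAddC (A H : Matrix m m ℝ) (t : ℝ) :
    (derivDetXAddC A H).eval t = (adjugate (t • (1 : Matrix m m ℝ) + A) * H).trace := by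
  have hsum : (fun B : Matrix m m ℝ => det (t • (1 : Matrix m m ℝ) + B)) = fun B =>
      ∑ k ∈ Finset.range (Fintype.card m + 1),
        (det ((X : ℝ[X]) • (1 : Matrix m m ℝ[X]) + B.map C)).coeff k * t ^ k := by
    funext B
    rw [← eval_det_X_add_C, eval_eq_sum_range' (Nat.lt_succ_of_le ?_)]
    simpa using natDegree_det_X_add_C_le (1 : Matrix m m ℝ) B
  have hshift : fderiv ℝ (det : Matrix m m ℝ → ℝ) (t • (1 : Matrix m m ℝ) + A)
      = fderiv ℝ (fun B : Matrix m m ℝ => det (t • (1 : Matrix m m ℝ) + B)) A :=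
    (fderiv_comp_add_left (t • (1 : Matrix m m ℝ))).symm
  have hderiv : fderiv ℝ (fun B : Matrix m m ℝ => det (t • (1 : Matrix m m ℝ) + B)) A =
      ∑ k ∈ Finset.range (Fintype.card m + 1), t ^ k • fderiv ℝ (fun B : Matrix m m ℝ =>
        (det ((X : ℝ[X]) • (1 : Matrix m m ℝ[X]) + B.map C)).coeff k) A := by
    rw [hsum]
    exact (HasFDerivAt.fun_sum fun k _ =>
      (differentiable_coeff_det_X_add_C k A).hasFDerivAt.mul_const (t ^ k)).fderiv
  rw [← fderiv_det, hshift, hderiv]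
  simp [derivDetXAddC, eval_finsetSum, mul_comm]

lemma derivDetXAddC_mul (A H : Matrix m m ℝ) :
    derivDetXAddC A (A * H) = det ((X : ℝ[X]) • (1 : Matrix m m ℝ[X]) + A.map C) * C H.trace
      - X * derivDetXAddC A H := by
  refine Polynomial.funext fun t => ?_
  have h : adjugate (t • (1 : Matrix m m ℝ) + A) * (A * H)
      = det (t • (1 : Matrix m m ℝ) + A) • H
        - t • (adjugate (t • (1 : Matrix m m ℝ) + A) * H) := by
    have h' := congrArg (· * H) (adjugate_mul (t • (1 : Matrix m m ℝ) + A))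
    simp only [mul_add, add_mul, mul_smul_comm, smul_mul_assoc, mul_one, one_mul,
      Matrix.mul_assoc] at h'
    exact eq_sub_of_add_eq' h'
  simp [eval_derivDetXAddC, eval_det_X_add_C, h, trace_sub, trace_smul]

end Matrix

/-- For every `0 ≤ k ≤ n - 1` the map `A ↦ E_k(A)` is Fréchet differentiable on the
space of `n × n` real matrices, and the derivatives satisfy the recursion
`D E_{k+1}(A)[H] = E_k(A) · tr(H) − D E_k(A)[A·H]`. -/
theorem matrixEsymm_differentiable_and_fderiv_recursion (n : ℕ) (hn : 1 ≤ n) :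
    ∀ k ≤ n - 1,
      Differentiable ℝ (matrixEsymm n k) ∧
      ∀ A H : Matrix (Fin n) (Fin n) ℝ,
        fderiv ℝ (matrixEsymm n (k + 1)) A H =
          matrixEsymm n k A * Matrix.trace H - fderiv ℝ (matrixEsymm n k) A (A * H) := by
  intro k hk
  refine ⟨Matrix.differentiable_coeff_det_X_add_C (n - k), fun A H => ?_⟩
  have hsub : n - k = n - (k + 1) + 1 := by omega
  have h := congrArg (coeff · (n - k)) (Matrix.derivDetXAddC_mul A H)
  simp only [coeff_sub, coeff_mul_C] at h
  rw [Matrix.coeff_derivDetXAddC A (A * H) (by simp), hsub, coeff_X_mul,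
    Matrix.coeff_derivDetXAddC A H (by simp), ← hsub] at h
  exact eq_sub_of_add_eq (eq_sub_iff_add_eq'.mp h)
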